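/- For any energy-admissible zero-error code of blocklength n on the noiseless binary two-way channel with energy exchange, with M₁ and M₂ uniform and independent, the rate of Node 1 satisfies log |M₁| ≤ Σ_{k=1}^{n} H[X_{1,k} | (U_{1,k}, X_{2,k})], where the entropies are Shannon entropies computed under the uniform probability measure on M₁ × M₂. -/

import Mathlib

/-!
Statement 0: Converse bound for Node 1's rate in the noiseless binary two-way
channel with energy exchange: for any energy-admissible zero-error code,
log |M₁| ≤ Σ_{k=1}^{n} H[X_{1,k} | (U_{1,k}, X_{2,k})],
entropies taken under the uniform measure on M₁ × M₂.
-/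

open Finset

/-- Probability that `X = v` under the uniform measure on a finite sample space `Ω`. -/
noncomputable def uprob {Ω V : Type*} [Fintype Ω] [DecidableEq V]
    (X : Ω → V) (v : V) : ℝ :=
  (Finset.univ.filter fun ω => X ω = v).card / (Fintype.card Ω : ℝ)

/-- Shannon entropy (natural log) of the random variable `X` under the uniform
measure on the finite sample space `Ω`. -/
noncomputable def uent {Ω V : Type*} [Fintype Ω] [DecidableEq V]
    (X : Ω → V) : ℝ :=
  ∑ v ∈ Finset.univ.image X, Real.negMulLog (uprob X v)

/-- Conditional Shannon entropy `H[X | Y] = H[(X,Y)] - H[Y]` under the uniform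
measure on the finite sample space `Ω`. -/
noncomputable def ucondEnt {Ω V W : Type*} [Fintype Ω] [DecidableEq V] [DecidableEq W]
    (X : Ω → V) (Y : Ω → W) : ℝ :=
  uent (fun ω => (X ω, Y ω)) - uent Y

/-- Entropy under the uniform measure as an average of log-probabilities. -/
theorem uent_eq_sum {Ω V : Type*} [Fintype Ω] [DecidableEq V] (X : Ω → V) :
    uent X = (∑ ω, -Real.log (uprob X (X ω))) / (Fintype.card Ω : ℝ) := by
  unfold uent
  rw [Finset.sum_comp (fun v => -Real.log (uprob X v)) X, Finset.sum_div]
  refine Finset.sum_congr rfl fun v _ => ?_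
  rw [nsmul_eq_mul, Real.negMulLog]
  conv_lhs => rw [uprob]
  rw [uprob]
  ring

theorem uprob_apply_pos {Ω V : Type*} [Fintype Ω] [DecidableEq V] (X : Ω → V) (ω : Ω) :
    0 < uprob X (X ω) := by
  unfold uprob
  have : 0 < (Finset.univ.filter fun ω' => X ω' = X ω).card :=
    Finset.card_pos.mpr ⟨ω, by simp⟩
  have : 0 < Fintype.card Ω := Fintype.card_pos_iff.mpr ⟨ω⟩
  positivity

/-- Entropy depends only on the partition of the sample space induced by the variable. -/
theorem uent_congr {Ω V W : Type*} [Fintype Ω] [DecidableEq V] [DecidableEq W]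
    {X : Ω → V} {Y : Ω → W} (h : ∀ ω ω', X ω = X ω' ↔ Y ω = Y ω') : uent X = uent Y := by
  rw [uent_eq_sum, uent_eq_sum]
  simp only [uprob, h]

theorem uent_eq_log_of_fiber_card {Ω V : Type*} [Fintype Ω] [Nonempty Ω] [DecidableEq V]
    (X : Ω → V) (c : ℕ) (h : ∀ ω, (Finset.univ.filter fun ω' => X ω' = X ω).card = c) :
    uent X = Real.log (Fintype.card Ω) - Real.log c := by
  have hN : (Fintype.card Ω : ℝ) ≠ 0 := by exact_mod_cast Fintype.card_ne_zero
  have hc : (c : ℝ) ≠ 0 := by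
    obtain ⟨ω⟩ := ‹Nonempty Ω›
    rw [← h ω]
    exact_mod_cast (Finset.card_pos.mpr ⟨ω, by simp⟩).ne'
  rw [uent_eq_sum]
  simp only [uprob, h, Real.log_div hc hN, Finset.sum_const, Finset.card_univ, nsmul_eq_mul]
  field_simp
  ring

/-- Summing the reciprocal fiber size over one fiber gives at most one. -/
theorem sum_fiber_inv_le_one {Ω V : Type*} [Fintype Ω] [DecidableEq V] (X : Ω → V) (v : V) :
    ∑ ω, (if X ω = v then ((Finset.univ.filter fun ω' => X ω' = X ω).card : ℝ)⁻¹ else 0) ≤ 1 := by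
  rw [← Finset.sum_filter]
  have : ∀ ω ∈ Finset.univ.filter (fun ω => X ω = v),
      ((Finset.univ.filter fun ω' => X ω' = X ω).card : ℝ)⁻¹
        = ((Finset.univ.filter fun ω' => X ω' = v).card : ℝ)⁻¹ := by
    intro ω hω
    rw [(Finset.mem_filter.mp hω).2]
  rw [Finset.sum_congr rfl this, Finset.sum_const, nsmul_eq_mul]
  exact mul_inv_le_one

theorem sum_fiber_ratio_le {Ω V A W : Type*} [Fintype Ω]
    [DecidableEq V] [DecidableEq A] [DecidableEq W]
    (X : Ω → V) (S : Ω → A) (Y : Ω → W) (h : ∀ ω ω', S ω = S ω' → Y ω = Y ω') :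
    ∑ ω, (((Finset.univ.filter fun ω' => S ω' = S ω).card : ℝ) *
        ((Finset.univ.filter fun ω' => (X ω', Y ω') = (X ω, Y ω)).card : ℝ)) /
        (((Finset.univ.filter fun ω' => (X ω', S ω') = (X ω, S ω)).card : ℝ) *
        ((Finset.univ.filter fun ω' => Y ω' = Y ω).card : ℝ)) ≤ Fintype.card Ω := by
  have expand : ∀ ω, (((Finset.univ.filter fun ω' => S ω' = S ω).card : ℝ) *
        ((Finset.univ.filter fun ω' => (X ω', Y ω') = (X ω, Y ω)).card : ℝ)) /
        (((Finset.univ.filter fun ω' => (X ω', S ω') = (X ω, S ω)).card : ℝ) *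
        ((Finset.univ.filter fun ω' => Y ω' = Y ω).card : ℝ)) =
      ∑ a, ∑ b, (if Y b = Y a then
          ((Finset.univ.filter fun ω' => Y ω' = Y a).card : ℝ)⁻¹ else 0) *
        (if (X ω, S ω) = (X b, S a) then
          ((Finset.univ.filter fun ω' => (X ω', S ω') = (X ω, S ω)).card : ℝ)⁻¹ else 0) := by
    intro ω
    rw [Finset.card_filter, Finset.card_filter, Nat.cast_sum, Nat.cast_sum,
      Finset.sum_mul_sum, Finset.sum_div]
    refine Finset.sum_congr rfl fun a _ => ?_
    rw [Finset.sum_div]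
    refine Finset.sum_congr rfl fun b _ => ?_
    by_cases hS : S a = S ω
    · have hY := h _ _ hS
      by_cases hX : X b = X ω
      · by_cases hb : Y b = Y ω
        · simp [hS, hX, hb, hY, div_eq_mul_inv, mul_comm]
        · simp [hb, hY]
      · simp [hX, Ne.symm hX]
    · simp [hS, Ne.symm hS]
  rw [Finset.sum_congr rfl fun ω _ => expand ω, Finset.sum_comm,
    Fintype.card_eq_sum_ones, Nat.cast_sum]
  refine Finset.sum_le_sum fun a _ => ?_
  rw [Finset.sum_comm, Nat.cast_one]
  simp only [← Finset.mul_sum]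
  calc _ ≤ ∑ b, (if Y b = Y a then
          ((Finset.univ.filter fun ω' => Y ω' = Y a).card : ℝ)⁻¹ else 0) := by
        refine Finset.sum_le_sum fun b _ => mul_le_of_le_one_right ?_
          (sum_fiber_inv_le_one (fun ω => (X ω, S ω)) (X b, S a))
        split_ifs <;> positivity
    _ ≤ 1 := by
        rw [← Finset.sum_filter, Finset.sum_const, nsmul_eq_mul]
        exact mul_inv_le_one

/-- Coarsening the conditioning variable does not decrease conditional entropy. -/
theorem ucondEnt_le_of_determines {Ω V A W : Type*} [Fintype Ω] [Nonempty Ω]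
    [DecidableEq V] [DecidableEq A] [DecidableEq W]
    (X : Ω → V) (S : Ω → A) (Y : Ω → W) (h : ∀ ω ω', S ω = S ω' → Y ω = Y ω') :
    ucondEnt X S ≤ ucondEnt X Y := by
  have hN : (0 : ℝ) < Fintype.card Ω := by exact_mod_cast Fintype.card_pos
  unfold ucondEnt
  simp only [uent_eq_sum]
  rw [← sub_div, ← sub_div, div_le_div_iff_of_pos_right hN, ← sub_nonpos,
    ← Finset.sum_sub_distrib, ← Finset.sum_sub_distrib, ← Finset.sum_sub_distrib]
  have hle := sum_fiber_ratio_le X S Y h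
  have term : ∀ ω,
      -Real.log (uprob (fun ω => (X ω, S ω)) (X ω, S ω)) - -Real.log (uprob S (S ω)) -
        (-Real.log (uprob (fun ω => (X ω, Y ω)) (X ω, Y ω)) - -Real.log (uprob Y (Y ω))) ≤
      (((Finset.univ.filter fun ω' => S ω' = S ω).card : ℝ) *
        ((Finset.univ.filter fun ω' => (X ω', Y ω') = (X ω, Y ω)).card : ℝ)) /
        (((Finset.univ.filter fun ω' => (X ω', S ω') = (X ω, S ω)).card : ℝ) *
        ((Finset.univ.filter fun ω' => Y ω' = Y ω).card : ℝ)) - 1 := by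
    intro ω
    have h1 := uprob_apply_pos S ω
    have h2 := uprob_apply_pos (fun ω => (X ω, Y ω)) ω
    have h3 := uprob_apply_pos (fun ω => (X ω, S ω)) ω
    have h4 := uprob_apply_pos Y ω
    have key := Real.log_le_sub_one_of_pos (div_pos (mul_pos h1 h2) (mul_pos h3 h4))
    rw [Real.log_div (mul_pos h1 h2).ne' (mul_pos h3 h4).ne', Real.log_mul h1.ne' h2.ne',
      Real.log_mul h3.ne' h4.ne'] at key
    have ratio : ∀ a b c d N : ℝ, 0 < N →
        (a / N * (b / N)) / (c / N * (d / N)) = a * b / (c * d) := by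
      intro a b c d N hN
      rw [div_mul_div_comm, div_mul_div_comm, div_div_div_cancel_right₀ (by positivity)]
    have := ratio _ _ _ _ _ hN ▸ key
    linarith
  refine (Finset.sum_le_sum fun ω _ => term ω).trans ?_
  rw [Finset.sum_sub_distrib, Finset.sum_const, Finset.card_univ, nsmul_eq_mul, mul_one]
  linarith

/-- For any energy-admissible zero-error code of blocklength `n` on the noiseless
binary two-way channel with energy exchange (total energy `U`, initial state `u₁`),
with the messages uniform and independent, the rate of Node 1 satisfies
`log |M₁| ≤ ∑_{k=0}^{n-1} H[X₁ₖ | (U₁ₖ, X₂ₖ)]` (channel uses indexed from 0). -/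
theorem node1_rate_outer_bound
    {M₁ M₂ : Type} [Fintype M₁] [Fintype M₂] [DecidableEq M₁] [DecidableEq M₂]
    [Nonempty M₁] [Nonempty M₂]
    (n U u₁ : ℕ) (hn : 1 ≤ n) (hU : 1 ≤ U) (hu₁ : u₁ ≤ U)
    -- encoders: at channel use k, a node maps its message and the past received
    -- symbols to the current transmitted symbol
    (f1 : (k : ℕ) → M₁ → (Fin k → Bool) → Bool)
    (f2 : (k : ℕ) → M₂ → (Fin k → Bool) → Bool)
    -- transmitted symbols and energy state of Node 1, as functions of the message pair
    (X1 X2 : M₁ × M₂ → ℕ → Bool) (U1 : M₁ × M₂ → ℕ → ℤ)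
    (hX1 : ∀ ω : M₁ × M₂, ∀ k < n, X1 ω k = f1 k ω.1 (fun i : Fin k => X2 ω i))
    (hX2 : ∀ ω : M₁ × M₂, ∀ k < n, X2 ω k = f2 k ω.2 (fun i : Fin k => X1 ω i))
    (hU0 : ∀ ω : M₁ × M₂, U1 ω 0 = (u₁ : ℤ))
    (hUrec : ∀ ω : M₁ × M₂, ∀ k < n,
      U1 ω (k + 1) = U1 ω k - (if X1 ω k then 1 else 0) + (if X2 ω k then 1 else 0))
    -- energy admissibility
    (hadm1 : ∀ ω : M₁ × M₂, ∀ k < n, U1 ω k = 0 → X1 ω k = false)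
    (hadm2 : ∀ ω : M₁ × M₂, ∀ k < n, U1 ω k = (U : ℤ) → X2 ω k = false)
    -- zero-error decodability at both nodes
    (hdec2 : ∃ g2 : M₂ → (Fin n → Bool) → M₁,
      ∀ ω : M₁ × M₂, g2 ω.2 (fun k : Fin n => X1 ω k) = ω.1)
    (hdec1 : ∃ g1 : M₁ → (Fin n → Bool) → M₂,
      ∀ ω : M₁ × M₂, g1 ω.1 (fun k : Fin n => X2 ω k) = ω.2) :
    Real.log (Fintype.card M₁ : ℝ) ≤
      ∑ k ∈ Finset.range n,
        ucondEnt (fun ω => X1 ω k) (fun ω => (U1 ω k, X2 ω k)) := by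
  have hsnd : uent (fun ω : M₁ × M₂ => (ω.2, fun i : Fin 0 => X1 ω i)) =
      Real.log (Fintype.card (M₁ × M₂)) - Real.log (Fintype.card M₁) := by
    refine uent_eq_log_of_fiber_card _ _ fun ω => ?_
    rw [← Finset.card_univ]
    refine Finset.card_bij' (fun p _ => p.1) (fun m _ => (m, ω.2)) ?_ ?_ ?_ ?_ <;>
      simp +contextual [Prod.ext_iff, funext_iff]
  have hall : uent (fun ω : M₁ × M₂ => (ω.2, fun i : Fin n => X1 ω i)) =
      Real.log (Fintype.card (M₁ × M₂)) := by
    obtain ⟨g2, hg2⟩ := hdec2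
    rw [uent_eq_log_of_fiber_card _ 1, Nat.cast_one, Real.log_one, sub_zero]
    intro ω
    rw [Finset.card_eq_one]
    refine ⟨ω, Finset.ext fun ω' => ?_⟩
    simp only [Finset.mem_filter, Finset.mem_univ, true_and, Finset.mem_singleton]
    refine ⟨fun he => ?_, fun he => by rw [he]⟩
    rw [Prod.mk.injEq] at he
    refine Prod.ext ?_ he.1
    rw [← hg2 ω', ← hg2 ω, he.1, he.2]
  have step : ∀ k ∈ Finset.range n,
      uent (fun ω : M₁ × M₂ => (ω.2, fun i : Fin (k + 1) => X1 ω i)) -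
        uent (fun ω : M₁ × M₂ => (ω.2, fun i : Fin k => X1 ω i)) ≤
      ucondEnt (fun ω => X1 ω k) (fun ω => (U1 ω k, X2 ω k)) := by
    intro k hk
    rw [Finset.mem_range] at hk
    have hchain : uent (fun ω : M₁ × M₂ => (ω.2, fun i : Fin (k + 1) => X1 ω i)) =
        uent (fun ω : M₁ × M₂ => (X1 ω k, (ω.2, fun i : Fin k => X1 ω i))) := by
      refine uent_congr fun ω ω' => ?_
      simp only [Prod.mk.injEq, funext_iff, Fin.forall_fin_succ', Fin.val_castSucc, Fin.val_last]
      tauto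
    rw [hchain]
    refine ucondEnt_le_of_determines (fun ω => X1 ω k) _ _ fun ω ω' he => ?_
    simp only [Prod.mk.injEq, funext_iff, Fin.forall_iff] at he
    obtain ⟨h2, h1⟩ := he
    have hx2 : ∀ j ≤ k, X2 ω j = X2 ω' j := by
      intro j hj
      rw [hX2 ω j (by omega), hX2 ω' j (by omega), h2]
      congr 1
      funext i
      exact h1 i (by omega)
    have hu : ∀ j ≤ k, U1 ω j = U1 ω' j := by
      intro j
      induction j with
      | zero => intro _; rw [hU0, hU0]
      | succ j ih =>
        intro hj
        rw [hUrec ω j (by omega), hUrec ω' j (by omega), ih (by omega), h1 j (by omega),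
          hx2 j (by omega)]
    rw [hu k le_rfl, hx2 k le_rfl]
  have hsum := Finset.sum_le_sum step
  rw [Finset.sum_range_sub
    (fun k => uent (fun ω : M₁ × M₂ => (ω.2, fun i : Fin k => X1 ω i))), hall, hsnd] at hsum
  linarith
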